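/- arXiv:1401.3172 — 3 statements merged into one kernel-verified Lean document; each statement's English description precedes it below -/
import Mathlib

section
/- Let λ1, λ2 ≥ 1 be real numbers, let s2 > 0 and α ≥ 1 be real numbers, and set s1 = α·s2. Then a real number γ > 0 is the aspect ratio of some vertical merge of a module of area s1 and bounding factor λ1 with a module of area s2 and bounding factor λ2 (i.e., there exist reals w, h1, h2 > 0 with w·h1 = s1, w·h2 = s2, 1/λ1 ≤ h1/w ≤ λ1, 1/λ2 ≤ h2/w ≤ λ2, and (h1 + h2)/w = γ) if and only if max((1+α)/(α·λ1), (1+α)/λ2) ≤ γ ≤ min((1 + 1/α)·λ1, (1+α)·λ2). -/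
theorem bounds_aux (l1 l2 a r : ℝ) (h1 : 1 ≤ l1) (h2 : 1 ≤ l2) (ha : 1 ≤ a) :
    (max ((1 + a) / (a * l1)) ((1 + a) / l2) ≤ (1 + a) * r ∧
       (1 + a) * r ≤ min ((1 + 1 / a) * l1) ((1 + a) * l2)) ↔
    (1 / l1 ≤ a * r ∧ a * r ≤ l1 ∧ 1 / l2 ≤ r ∧ r ≤ l2) := by
  have ha0 : 0 < a := by linarith
  have hb : 0 < 1 + a := by linarith
  have p1 : 0 < l1 := by linarith
  have p2 : 0 < l2 := by linarith
  have e1 : (1 + a) / (a * l1) = (1 + a) * (1 / l1 / a) := by field_simp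
  have e2 : (1 + a) / l2 = (1 + a) * (1 / l2) := by field_simp
  have e3 : (1 + 1 / a) * l1 = (1 + a) * (l1 / a) := by field_simp; ring
  rw [max_le_iff, le_min_iff, e1, e2, e3, mul_le_mul_iff_right₀ hb, mul_le_mul_iff_right₀ hb,
    mul_le_mul_iff_right₀ hb, mul_le_mul_iff_right₀ hb, div_le_iff₀' ha0, le_div_iff₀' ha0]
  tauto

theorem vertical_merge_aspect_ratio_iff
    (lam1 lam2 s2 alpha gamma : ℝ)
    (hlam1 : 1 ≤ lam1) (hlam2 : 1 ≤ lam2)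
    (hs2 : 0 < s2) (halpha : 1 ≤ alpha)
    (s1 : ℝ) (hs1 : s1 = alpha * s2)
    (hgamma : 0 < gamma) :
    (∃ w h1 h2 : ℝ, 0 < w ∧ 0 < h1 ∧ 0 < h2 ∧
      w * h1 = s1 ∧ w * h2 = s2 ∧
      1 / lam1 ≤ h1 / w ∧ h1 / w ≤ lam1 ∧
      1 / lam2 ≤ h2 / w ∧ h2 / w ≤ lam2 ∧
      (h1 + h2) / w = gamma)
    ↔ (max ((1 + alpha) / (alpha * lam1)) ((1 + alpha) / lam2) ≤ gamma ∧
       gamma ≤ min ((1 + 1 / alpha) * lam1) ((1 + alpha) * lam2)) := by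
  have ha0 : 0 < alpha := by linarith
  have hb : 0 < 1 + alpha := by linarith
  constructor
  · rintro ⟨w, h1, h2, hw, -, -, e1, e2, b1, b2, b3, b4, e⟩
    have hh : h1 = alpha * h2 := by
      apply mul_left_cancel₀ hw.ne'
      rw [e1, hs1, ← e2]; ring
    have hr : h1 / w = alpha * (h2 / w) := by rw [hh]; ring
    have hg : gamma = (1 + alpha) * (h2 / w) := by rw [← e, hh]; ring
    rw [hr] at b1 b2
    rw [hg]
    exact (bounds_aux lam1 lam2 alpha _ hlam1 hlam2 halpha).2 ⟨b1, b2, b3, b4⟩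
  · intro h
    obtain ⟨r, hr⟩ : ∃ r, gamma = (1 + alpha) * r := ⟨gamma / (1 + alpha), by field_simp⟩
    have hr0 : 0 < r := by
      rw [hr] at hgamma
      exact pos_of_mul_pos_right hgamma hb.le
    rw [hr] at h
    obtain ⟨b1, b2, b3, b4⟩ := (bounds_aux lam1 lam2 alpha _ hlam1 hlam2 halpha).1 h
    have hw : 0 < √(s2 / r) := Real.sqrt_pos.2 (by positivity)
    have hsq : √(s2 / r) * √(s2 / r) = s2 / r := Real.mul_self_sqrt (by positivity)
    generalize √(s2 / r) = w at hw hsq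
    have hs : w * (r * w) = s2 := by
      rw [eq_div_iff hr0.ne'] at hsq
      linarith
    have d1 : alpha * (r * w) / w = alpha * r := by field_simp
    have d2 : r * w / w = r := by field_simp
    refine ⟨w, alpha * (r * w), r * w, hw, by positivity, by positivity, ?_, hs, ?_, ?_, ?_, ?_, ?_⟩
    · rw [hs1, ← hs]; ring
    · rwa [d1]
    · rwa [d1]
    · rwa [d2]
    · rwa [d2]
    · rw [add_div, d1, d2, hr]; ring
end

section
/- Let λ1 > 1 and λ2 > 1 be real numbers, let s2 > 0 and α ≥ 1 be real numbers with 1/(λ1 - 1) ≤ α ≤ λ2 - 1, and set s1 = α·s2 and λc = min((1 + 1/α)·λ1, (1+α)·λ2). Then λc ≥ min(λ1, λ2), and for every real γ with 1 ≤ γ ≤ λc there exist reals w, h1, h2 > 0 with w·h1 = s1, w·h2 = s2, 1/λ1 ≤ h1/w ≤ λ1, 1/λ2 ≤ h2/w ≤ λ2, and (h1 + h2)/w = γ. -/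
theorem feasible_vertical_merge
    (lam1 lam2 s2 alpha : ℝ)
    (hlam1 : 1 < lam1) (hlam2 : 1 < lam2)
    (hs2 : 0 < s2) (halpha : 1 ≤ alpha)
    (hlo : 1 / (lam1 - 1) ≤ alpha) (hhi : alpha ≤ lam2 - 1)
    (s1 lamc : ℝ) (hs1 : s1 = alpha * s2)
    (hlamc : lamc = min ((1 + 1 / alpha) * lam1) ((1 + alpha) * lam2)) :
    lamc ≥ min lam1 lam2 ∧
    ∀ gamma : ℝ, 1 ≤ gamma → gamma ≤ lamc →
      ∃ w h1 h2 : ℝ, 0 < w ∧ 0 < h1 ∧ 0 < h2 ∧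
        w * h1 = s1 ∧ w * h2 = s2 ∧
        1 / lam1 ≤ h1 / w ∧ h1 / w ≤ lam1 ∧
        1 / lam2 ≤ h2 / w ∧ h2 / w ≤ lam2 ∧
        (h1 + h2) / w = gamma := by
  have ha : 0 < alpha := by linarith
  have h1a : 0 < 1 + alpha := by linarith
  have hl1 : 0 < lam1 := by linarith
  have hl2 : 0 < lam2 := by linarith
  have hia : 0 < 1 / alpha := by positivity
  refine ⟨?_, ?_⟩
  · rw [hlamc]
    apply min_le_min
    · nlinarith [mul_pos hia hl1]
    · nlinarith [mul_pos ha hl2]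
  intro g hg1 hg
  rw [hlamc] at hg
  have hgA : g ≤ (1 + 1 / alpha) * lam1 := hg.trans (min_le_left _ _)
  have hgB : g ≤ (1 + alpha) * lam2 := hg.trans (min_le_right _ _)
  have hg0 : 0 < g := by linarith
  have hlo2 : 1 ≤ alpha * (lam1 - 1) := by
    rwa [div_le_iff₀ (by linarith)] at hlo
  have hgA2 : alpha * g ≤ (1 + alpha) * lam1 := by
    have h := mul_le_mul_of_nonneg_left hgA ha.le
    have e : alpha * ((1 + 1 / alpha) * lam1) = (1 + alpha) * lam1 := by
      field_simp
      ring
    linarith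
  obtain ⟨w, hw, hww⟩ : ∃ w : ℝ, 0 < w ∧ w * w = (1 + alpha) * s2 / g :=
    ⟨Real.sqrt ((1 + alpha) * s2 / g), Real.sqrt_pos.mpr (by positivity),
      Real.mul_self_sqrt (by positivity)⟩
  have e1 : alpha * g / (1 + alpha) * w / w = alpha * g / (1 + alpha) := by
    field_simp
  have e2 : g / (1 + alpha) * w / w = g / (1 + alpha) := by
    field_simp
  refine ⟨w, alpha * g / (1 + alpha) * w, g / (1 + alpha) * w, hw, by positivity,
    by positivity, ?_, ?_, ?_, ?_, ?_, ?_, ?_⟩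
  · have : w * (alpha * g / (1 + alpha) * w) = alpha * g / (1 + alpha) * (w * w) := by ring
    rw [this, hww, hs1]
    field_simp
  · have : w * (g / (1 + alpha) * w) = g / (1 + alpha) * (w * w) := by ring
    rw [this, hww]
    field_simp
  · rw [e1, div_le_div_iff₀ hl1 h1a]
    nlinarith [mul_nonneg (mul_pos ha hl1).le (sub_nonneg.mpr hg1)]
  · rw [e1, div_le_iff₀ h1a]
    linarith
  · rw [e2, div_le_div_iff₀ hl2 h1a]
    nlinarith [mul_nonneg hl2.le (sub_nonneg.mpr hg1)]
  · rw [e2, div_le_iff₀ h1a]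
    linarith
  · rw [add_div, e1, e2]
    field_simp
    ring
end

section
/- Let λ ≥ 3 be a real number and let s1 ≥ s2 > 0 be real numbers with s1/s2 ≤ λ - 1. Then for every real γ with 1/λ ≤ γ ≤ λ, either there exist reals w, h1, h2 > 0 with w·h1 = s1, w·h2 = s2, 1/λ ≤ h1/w ≤ λ, 1/λ ≤ h2/w ≤ λ, and (h1 + h2)/w = γ, or there exist reals h, w1, w2 > 0 with w1·h = s1, w2·h = s2, 1/λ ≤ h/w1 ≤ λ, 1/λ ≤ h/w2 ≤ λ, and h/(w1 + w2) = γ. In particular, two modules of areas s1 and s2 with the uniform bounding factor λ can be merged into a feasible composite module of any prescribed aspect ratio in [1/λ, λ]. -/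
theorem uniform_bound_merge_any_ratio
    (lam s1 s2 : ℝ)
    (hlam : 3 ≤ lam) (hs2 : 0 < s2) (hs12 : s2 ≤ s1)
    (hratio : s1 / s2 ≤ lam - 1) :
    ∀ gamma : ℝ, 1 / lam ≤ gamma → gamma ≤ lam →
      (∃ w h1 h2 : ℝ, 0 < w ∧ 0 < h1 ∧ 0 < h2 ∧
        w * h1 = s1 ∧ w * h2 = s2 ∧
        1 / lam ≤ h1 / w ∧ h1 / w ≤ lam ∧
        1 / lam ≤ h2 / w ∧ h2 / w ≤ lam ∧
        (h1 + h2) / w = gamma) ∨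
      (∃ h w1 w2 : ℝ, 0 < h ∧ 0 < w1 ∧ 0 < w2 ∧
        w1 * h = s1 ∧ w2 * h = s2 ∧
        1 / lam ≤ h / w1 ∧ h / w1 ≤ lam ∧
        1 / lam ≤ h / w2 ∧ h / w2 ≤ lam ∧
        h / (w1 + w2) = gamma) := by
  intro g hg1 hg2
  have hl : 0 < lam := by linarith
  have hs1 : 0 < s1 := by linarith
  have hg : 0 < g := lt_of_lt_of_le (by positivity) hg1
  have hS : 0 < s1 + s2 := by linarith
  have hr : s1 + s2 ≤ lam * s2 := by
    rw [div_le_iff₀ hs2] at hratio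
    linarith
  have hgl : 1 ≤ g * lam := by
    rwa [div_le_iff₀ hl] at hg1
  rcases le_total 1 g with h1 | h1
  · left
    have hp : 0 < (s1 + s2) / g := by positivity
    have hw : 0 < √((s1 + s2) / g) := Real.sqrt_pos.2 hp
    have hsq : √((s1 + s2) / g) * √((s1 + s2) / g) = (s1 + s2) / g :=
      Real.mul_self_sqrt hp.le
    have key : ∀ s : ℝ, s / √((s1 + s2) / g) / √((s1 + s2) / g) = s * g / (s1 + s2) := by
      intro s
      rw [div_div, hsq, div_div_eq_mul_div]
    have e1 : s1 + s2 ≤ lam * s2 * g := by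
      nlinarith [mul_pos hl hs2]
    have e2 : lam * s2 * g ≤ lam * s1 * g := by gcongr
    refine ⟨√((s1 + s2) / g), s1 / √((s1 + s2) / g), s2 / √((s1 + s2) / g), hw,
      by positivity, by positivity, by field_simp, by field_simp, ?_, ?_, ?_, ?_, ?_⟩
    · rw [key, div_le_div_iff₀ hl hS]; linarith
    · rw [key, div_le_iff₀ hS]; nlinarith
    · rw [key, div_le_div_iff₀ hl hS]; linarith
    · rw [key, div_le_iff₀ hS]; nlinarith
    · rw [← add_div, key]; field_simp
  · right
    have hp : 0 < (s1 + s2) * g := by positivity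
    have hw : 0 < √((s1 + s2) * g) := Real.sqrt_pos.2 hp
    have hsq : √((s1 + s2) * g) * √((s1 + s2) * g) = (s1 + s2) * g :=
      Real.mul_self_sqrt hp.le
    have key : ∀ s : ℝ, √((s1 + s2) * g) / (s / √((s1 + s2) * g)) = (s1 + s2) * g / s := by
      intro s
      rw [div_div_eq_mul_div, hsq]
    have e1 : (s1 + s2) * g ≤ lam * s2 := by nlinarith
    have e2 : lam * s2 ≤ lam * s1 := by gcongr
    have e3 : s1 + s2 ≤ (s1 + s2) * g * lam := by nlinarith
    refine ⟨√((s1 + s2) * g), s1 / √((s1 + s2) * g), s2 / √((s1 + s2) * g), hw,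
      by positivity, by positivity, by field_simp, by field_simp, ?_, ?_, ?_, ?_, ?_⟩
    · rw [key, div_le_div_iff₀ hl hs1]; linarith
    · rw [key, div_le_iff₀ hs1]; linarith
    · rw [key, div_le_div_iff₀ hl hs2]; linarith
    · rw [key, div_le_iff₀ hs2]; linarith
    · rw [← add_div, key]; field_simp
end
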